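/- For every s ≥ 1/4 there is C > 0 such that for all u, z : ℤ → [0,∞) with ‖u‖_{ℓ²}, ‖z‖_{ℓ²} < ∞: ∑_{k∈ℤ} ∑_{k₁+k₂+k₃=k, Φ(k̄)≠0} M₁ · u(k₁)³ u(k₂) u(k₃) z(k) ≤ C ‖u‖⁵_{ℓ²} ‖z‖_{ℓ²}, where M₁ := |k| ⟨k⟩^{s} ⟨k₁⟩ / (|Φ(k̄)| ⟨k₁⟩^{3s} ⟨k₂⟩^{s} ⟨k₃⟩^{s}). -/

import Mathlib

open scoped ENNReal

/-- Japanese bracket `⟨k⟩ = 1 + |k|`. -/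
noncomputable def jb (k : ℤ) : ℝ := 1 + |(k : ℝ)|

/-- `‖u‖_{ℓ²} = (∑_k u(k)²)^{1/2}`, valued in `[0,∞]`. -/
noncomputable def l2 (u : ℤ → ℝ) : ℝ≥0∞ :=
  (∑' k : ℤ, ENNReal.ofReal (u k ^ 2)) ^ (1 / 2 : ℝ)

/-- `Φ(k̄) = k³ − k₁³ − k₂³ − k₃³` with `k = k₁ + k₂ + k₃`. -/
def Phi (k₁ k₂ k₃ : ℤ) : ℤ := (k₁ + k₂ + k₃) ^ 3 - k₁ ^ 3 - k₂ ^ 3 - k₃ ^ 3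

/-- The multiplier `M₁ = |k| ⟨k⟩^s ⟨k₁⟩ / (|Φ(k̄)| ⟨k₁⟩^{3s} ⟨k₂⟩^s ⟨k₃⟩^s)`. -/
noncomputable def M1 (s : ℝ) (k₁ k₂ k₃ : ℤ) : ℝ :=
  |((k₁ + k₂ + k₃ : ℤ) : ℝ)| * jb (k₁ + k₂ + k₃) ^ s * jb k₁ /
    (|((Phi k₁ k₂ k₃ : ℤ) : ℝ)| * jb k₁ ^ (3 * s) * jb k₂ ^ s * jb k₃ ^ s)

lemma one_le_jb (k : ℤ) : 1 ≤ jb k := by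
  unfold jb; linarith [abs_nonneg (k : ℝ)]

lemma jb_pos (k : ℤ) : 0 < jb k := zero_lt_one.trans_le (one_le_jb k)

lemma jb_add_le (m n : ℤ) : jb (m + n) ≤ jb m * jb n := by
  unfold jb
  push_cast
  nlinarith [abs_add_le (m : ℝ) n, mul_nonneg (abs_nonneg (m : ℝ)) (abs_nonneg (n : ℝ))]

lemma jb_le_two_mul_abs {n : ℤ} (hn : n ≠ 0) : jb n ≤ 2 * |(n : ℝ)| := by
  have h : (1 : ℝ) ≤ |(n : ℝ)| := by exact_mod_cast Int.one_le_abs hn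
  unfold jb; linarith

lemma Phi_eq (k₁ k₂ k₃ : ℤ) : Phi k₁ k₂ k₃ = 3 * (k₁ + k₂) * (k₂ + k₃) * (k₃ + k₁) := by
  unfold Phi; ring

/-- The summable weight `⟨n⟩^{-3/2}`. -/
noncomputable def weight (n : ℤ) : ℝ := (√(jb n))⁻¹ ^ 3

lemma weight_nonneg (n : ℤ) : 0 ≤ weight n := by unfold weight; positivity

lemma summable_weight : Summable weight := by
  refine Summable.of_nonneg_of_le weight_nonneg (fun n => ?_)
    ((Real.summable_one_div_int_add_rpow (1 / 2) (3 / 2)).2 (by norm_num))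
  have hpos : 0 < |(n : ℝ) + 1 / 2| := by
    rw [abs_pos]
    intro h
    have h2 : (2 * n + 1 : ℤ) = 0 := by
      have : (2 * (n : ℝ) + 1) = 0 := by linarith
      exact_mod_cast this
    omega
  have hle : |(n : ℝ) + 1 / 2| ≤ jb n := by
    refine (abs_add_le _ _).trans ?_
    unfold jb
    rw [abs_of_pos (by norm_num : (0 : ℝ) < 1 / 2)]
    linarith
  have hw : weight n = 1 / jb n ^ (3 / 2 : ℝ) := by
    rw [weight, inv_pow, one_div, Real.sqrt_eq_rpow, ← Real.rpow_natCast,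
      ← Real.rpow_mul (jb_pos n).le]
    norm_num
  rw [hw]
  gcongr

/-- Elementary inequality behind the kernel bound, when `B ≤ A`. -/
lemma kernel_aux_of_le {A B P Q : ℝ} (hB : 1 ≤ B) (hP : 1 ≤ P) (hQ : 1 ≤ Q)
    (hBA : B ≤ A) (hA : A ^ 2 ≤ B ^ 2 + P ^ 2 + Q ^ 2) :
    (A ^ 2 + B ^ 2) ^ 2 * (A * B + P * Q) / (A ^ 4 * B ^ 4 * (P * Q)) ≤
      16 * (B⁻¹ ^ 3 + P⁻¹ ^ 3 + Q⁻¹ ^ 3) := by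
  have hA0 : 0 < A := by linarith
  have hB0 : 0 < B := by linarith
  have hP0 : 0 < P := by linarith
  have hQ0 : 0 < Q := by linarith
  have hsum : A ≤ B + P + Q := by
    refine abs_le_of_sq_le_sq' ?_ (by positivity) |>.2
    nlinarith [mul_pos hB0 hP0, mul_pos hB0 hQ0, mul_pos hP0 hQ0]
  have h1 : (A ^ 2 + B ^ 2) ^ 2 ≤ 4 * A ^ 4 := by
    have : B ^ 2 ≤ A ^ 2 := by gcongr
    nlinarith [sq_nonneg A, sq_nonneg B]
  calc (A ^ 2 + B ^ 2) ^ 2 * (A * B + P * Q) / (A ^ 4 * B ^ 4 * (P * Q))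
      ≤ 4 * A ^ 4 * ((B + P + Q) * B + P * Q) / (A ^ 4 * B ^ 4 * (P * Q)) := by gcongr
    _ = 4 * (B⁻¹ ^ 2 * P⁻¹ * Q⁻¹ + B⁻¹ ^ 3 * Q⁻¹ + B⁻¹ ^ 3 * P⁻¹ + B⁻¹ ^ 4) := by
        field_simp
    _ ≤ 16 * (B⁻¹ ^ 3 + P⁻¹ ^ 3 + Q⁻¹ ^ 3) := by
        have hb1 := inv_le_one_of_one_le₀ hB
        have hp1 := inv_le_one_of_one_le₀ hP
        have hq1 := inv_le_one_of_one_le₀ hQ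
        have hb0 := inv_pos.2 hB0
        have hp0 := inv_pos.2 hP0
        have hq0 := inv_pos.2 hQ0
        generalize B⁻¹ = b at *
        generalize P⁻¹ = p at *
        generalize Q⁻¹ = q at *
        have hb3 : 0 < b ^ 3 := by positivity
        have hp3 : 0 < p ^ 3 := by positivity
        have hq3 : 0 < q ^ 3 := by positivity
        have e1 : b ^ 3 * q ≤ b ^ 3 := mul_le_of_le_one_right hb3.le hq1
        have e2 : b ^ 3 * p ≤ b ^ 3 := mul_le_of_le_one_right hb3.le hp1
        have e3 : b ^ 4 ≤ b ^ 3 := pow_le_pow_of_le_one hb0.le hb1 (by norm_num)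
        have e4 : b ^ 2 * p * q ≤ b * p * q := by
          have : b ^ 2 ≤ b := by nlinarith
          gcongr
        have e5 : 3 * (b * p * q) ≤ b ^ 3 + p ^ 3 + q ^ 3 := by
          have h : 0 ≤ (b + p + q) * ((b - p) ^ 2 + (p - q) ^ 2 + (q - b) ^ 2) := by positivity
          nlinarith [h]
        linarith

/-- Elementary inequality behind the kernel bound. -/
lemma kernel_aux {A B P Q : ℝ} (hA1 : 1 ≤ A) (hB1 : 1 ≤ B) (hP : 1 ≤ P) (hQ : 1 ≤ Q)
    (hA : A ^ 2 ≤ B ^ 2 + P ^ 2 + Q ^ 2) (hB : B ^ 2 ≤ A ^ 2 + P ^ 2 + Q ^ 2) :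
    (A ^ 2 + B ^ 2) ^ 2 * (A * B + P * Q) / (A ^ 4 * B ^ 4 * (P * Q)) ≤
      16 * (A⁻¹ ^ 3 + B⁻¹ ^ 3 + P⁻¹ ^ 3 + Q⁻¹ ^ 3) := by
  have hA0 : 0 < A⁻¹ ^ 3 := by positivity
  have hB0 : 0 < B⁻¹ ^ 3 := by positivity
  rcases le_total B A with h | h
  · linarith [kernel_aux_of_le hB1 hP hQ h hA]
  · have := kernel_aux_of_le hA1 hP hQ h hB
    rw [show (B ^ 2 + A ^ 2) ^ 2 * (B * A + P * Q) / (B ^ 4 * A ^ 4 * (P * Q)) =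
      (A ^ 2 + B ^ 2) ^ 2 * (A * B + P * Q) / (A ^ 4 * B ^ 4 * (P * Q)) by ring_nf] at this
    linarith

lemma M1_nonneg (s : ℝ) (k₁ k₂ k₃ : ℤ) : 0 ≤ M1 s k₁ k₂ k₃ := by
  have h (n : ℤ) := jb_pos n
  have := h k₁; have := h k₂; have := h k₃; have := h (k₁ + k₂ + k₃)
  unfold M1; positivity

lemma M1_sq_le {s : ℝ} (hs : 1 / 4 ≤ s) (k₁ k₂ k₃ : ℤ) :
    M1 s k₁ k₂ k₃ ^ 2 ≤ (((k₁ + k₂ + k₃ : ℤ) : ℝ)) ^ 2 * √(jb (k₁ + k₂ + k₃) * jb k₁) /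
      (((Phi k₁ k₂ k₃ : ℤ) : ℝ) ^ 2 * (√(jb k₂) * √(jb k₃))) := by
  have hle : jb (k₁ + k₂ + k₃) ≤ jb k₁ * jb k₂ * jb k₃ :=
    (jb_add_le _ _).trans (mul_le_mul_of_nonneg_right (jb_add_le _ _) (jb_pos _).le)
  unfold M1
  have h1 := jb_pos k₁
  have h1' := one_le_jb k₁
  have h2 := jb_pos k₂
  have h3 := jb_pos k₃
  have h := jb_pos (k₁ + k₂ + k₃)
  generalize (((k₁ + k₂ + k₃ : ℤ) : ℝ)) = k
  generalize ((Phi k₁ k₂ k₃ : ℤ) : ℝ) = F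
  generalize jb (k₁ + k₂ + k₃) = x at *
  generalize jb k₁ = x₁ at *
  generalize jb k₂ = x₂ at *
  generalize jb k₃ = x₃ at *
  have hR0 : 0 < x / (x₁ ^ 3 * x₂ * x₃) := by positivity
  have hR1 : x / (x₁ ^ 3 * x₂ * x₃) ≤ 1 := by
    rw [div_le_one (by positivity)]
    refine hle.trans ?_
    gcongr
    exact le_self_pow₀ h1' (by norm_num)
  have key : (x / (x₁ ^ 3 * x₂ * x₃)) ^ s ≤ (x / (x₁ ^ 3 * x₂ * x₃)) ^ (1 / 4 : ℝ) :=
    Real.rpow_le_rpow_of_exponent_ge hR0 hR1 hs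
  have e1 : |k| * x ^ s * x₁ / (|F| * x₁ ^ (3 * s) * x₂ ^ s * x₃ ^ s) =
      |k| * x₁ / |F| * (x / (x₁ ^ 3 * x₂ * x₃)) ^ s := by
    rw [Real.div_rpow h.le (by positivity), Real.mul_rpow (by positivity) h3.le,
      Real.mul_rpow (by positivity) h2.le, ← Real.rpow_natCast x₁ 3, ← Real.rpow_mul h1.le]
    simp only [div_eq_mul_inv, mul_inv]
    push_cast
    ring
  have e2 : ((x / (x₁ ^ 3 * x₂ * x₃)) ^ (1 / 4 : ℝ)) ^ 2 = √(x * x₁) / (x₁ ^ 2 * (√x₂ * √x₃)) := by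
    rw [← Real.rpow_natCast, ← Real.rpow_mul hR0.le,
      show x / (x₁ ^ 3 * x₂ * x₃) = x * x₁ / ((x₁ ^ 2) ^ 2 * (x₂ * x₃)) by field_simp]
    rw [show (1 / 4 * ((2 : ℕ) : ℝ)) = 1 / 2 by norm_num, ← Real.sqrt_eq_rpow,
      Real.sqrt_div (by positivity), Real.sqrt_mul (by positivity) (x₂ * x₃),
      Real.sqrt_sq (by positivity), Real.sqrt_mul h2.le]
  calc (|k| * x ^ s * x₁ / (|F| * x₁ ^ (3 * s) * x₂ ^ s * x₃ ^ s)) ^ 2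
      ≤ (|k| * x₁ / |F| * (x / (x₁ ^ 3 * x₂ * x₃)) ^ (1 / 4 : ℝ)) ^ 2 := by rw [e1]; gcongr
    _ = k ^ 2 * √(x * x₁) / (F ^ 2 * (√x₂ * √x₃)) := by
        rw [mul_pow, e2, div_pow, mul_pow, sq_abs, sq_abs]
        rcases eq_or_ne F 0 with rfl | hF
        · simp
        · field_simp

lemma inv_sqrt_abs_pow_le {n : ℤ} (hn : n ≠ 0) : (√|(n : ℝ)|)⁻¹ ^ 3 ≤ 4 * weight n := by
  have hn0 : 0 < |(n : ℝ)| := by positivity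
  have h1 : √(jb n) ≤ √2 * √|(n : ℝ)| := by
    rw [← Real.sqrt_mul (by norm_num)]
    exact Real.sqrt_le_sqrt (jb_le_two_mul_abs hn)
  have h2 : √2 ^ 3 ≤ 4 := by
    have hs := Real.sq_sqrt (show (0 : ℝ) ≤ 2 by norm_num)
    nlinarith [Real.sqrt_nonneg (2 : ℝ)]
  have hj := Real.sqrt_pos.2 (jb_pos n)
  have ha := Real.sqrt_pos.2 hn0
  unfold weight
  rw [inv_pow, inv_pow, ← div_eq_mul_inv, le_div_iff₀ (by positivity),
    inv_mul_le_iff₀ (by positivity)]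
  calc √(jb n) ^ 3 ≤ (√2 * √|(n : ℝ)|) ^ 3 := by gcongr
    _ = √2 ^ 3 * √|(n : ℝ)| ^ 3 := by ring
    _ ≤ 4 * √|(n : ℝ)| ^ 3 := by gcongr
    _ = √|(n : ℝ)| ^ 3 * 4 := by ring

lemma M1_sq_le_weight {s : ℝ} (hs : 1 / 4 ≤ s) {k₁ k₂ k₃ : ℤ} (hΦ : Phi k₁ k₂ k₃ ≠ 0) :
    M1 s k₁ k₂ k₃ ^ 2 ≤
      128 * (weight (k₁ + k₂) + weight (k₃ + k₁) + weight k₂ + weight k₃) := by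
  refine (M1_sq_le hs k₁ k₂ k₃).trans ?_
  rw [Phi_eq] at hΦ ⊢
  have ha : k₁ + k₂ ≠ 0 := by rintro h; simp [h] at hΦ
  have hc : k₂ + k₃ ≠ 0 := by rintro h; simp [h] at hΦ
  have hb : k₃ + k₁ ≠ 0 := by rintro h; simp [h] at hΦ
  have wa := inv_sqrt_abs_pow_le ha
  have wb := inv_sqrt_abs_pow_le hb
  have ha1 : (1 : ℝ) ≤ |((k₁ + k₂ : ℤ) : ℝ)| := by exact_mod_cast Int.one_le_abs ha
  have hb1 : (1 : ℝ) ≤ |((k₃ + k₁ : ℤ) : ℝ)| := by exact_mod_cast Int.one_le_abs hb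
  have hc1 : (1 : ℝ) ≤ |((k₂ + k₃ : ℤ) : ℝ)| := by exact_mod_cast Int.one_le_abs hc
  have wp := weight_nonneg k₂
  have wq := weight_nonneg k₃
  set A := √|((k₁ + k₂ : ℤ) : ℝ)|
  set B := √|((k₃ + k₁ : ℤ) : ℝ)|
  set P := √(jb k₂)
  set Q := √(jb k₃)
  have sA : A ^ 2 = |((k₁ + k₂ : ℤ) : ℝ)| := Real.sq_sqrt (abs_nonneg _)
  have sB : B ^ 2 = |((k₃ + k₁ : ℤ) : ℝ)| := Real.sq_sqrt (abs_nonneg _)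
  have sP : P ^ 2 = jb k₂ := Real.sq_sqrt (jb_pos _).le
  have sQ : Q ^ 2 = jb k₃ := Real.sq_sqrt (jb_pos _).le
  have A1 : 1 ≤ A := Real.one_le_sqrt.2 ha1
  have B1 : 1 ≤ B := Real.one_le_sqrt.2 hb1
  have P1 : 1 ≤ P := Real.one_le_sqrt.2 (one_le_jb _)
  have Q1 : 1 ≤ Q := Real.one_le_sqrt.2 (one_le_jb _)
  have hAB : A ^ 2 ≤ B ^ 2 + P ^ 2 + Q ^ 2 := by
    rw [sA, sB, sP, sQ]
    have h1 := abs_add_le ((k₃ + k₁ : ℤ) : ℝ) ((k₂ - k₃ : ℤ) : ℝ)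
    have h2 := abs_sub (k₂ : ℝ) (k₃ : ℝ)
    unfold jb
    push_cast at *
    rw [show (k₃ + k₁ + (k₂ - k₃) : ℝ) = k₁ + k₂ by ring] at h1
    linarith
  have hBA : B ^ 2 ≤ A ^ 2 + P ^ 2 + Q ^ 2 := by
    rw [sA, sB, sP, sQ]
    have h1 := abs_sub ((k₁ + k₂ : ℤ) : ℝ) ((k₂ - k₃ : ℤ) : ℝ)
    have h2 := abs_sub (k₂ : ℝ) (k₃ : ℝ)
    unfold jb
    push_cast at *
    rw [show (k₁ + k₂ - (k₂ - k₃) : ℝ) = k₃ + k₁ by ring] at h1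
    linarith
  have hk : |((k₁ + k₂ + k₃ : ℤ) : ℝ)| ≤ |((k₂ + k₃ : ℤ) : ℝ)| * (A ^ 2 + B ^ 2) := by
    rw [sA, sB]
    have h1 := abs_add_three ((k₁ + k₂ : ℤ) : ℝ) ((k₂ + k₃ : ℤ) : ℝ) ((k₃ + k₁ : ℤ) : ℝ)
    have h2 : |((k₁ + k₂ : ℤ) : ℝ) + ((k₂ + k₃ : ℤ) : ℝ) + ((k₃ + k₁ : ℤ) : ℝ)| =
        2 * |((k₁ + k₂ + k₃ : ℤ) : ℝ)| := by
      rw [show (2 : ℝ) * |((k₁ + k₂ + k₃ : ℤ) : ℝ)| = |2 * ((k₁ + k₂ + k₃ : ℤ) : ℝ)| by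
        rw [abs_mul, abs_two]]
      push_cast; ring_nf
    nlinarith
  have hprod : √(jb (k₁ + k₂ + k₃) * jb k₁) ≤ 2 * (A * B + P * Q) := by
    refine Real.sqrt_le_iff.2 ⟨by positivity, ?_⟩
    have hsq : jb (k₁ + k₂ + k₃) * jb k₁ ≤ 4 * (A ^ 2 * B ^ 2 + P ^ 2 * Q ^ 2) := by
      rw [sA, sB, sP, sQ]
      have h1 : |((k₁ + k₂ + k₃ : ℤ) : ℝ)| * |(k₁ : ℝ)| ≤
          |((k₁ + k₂ : ℤ) : ℝ)| * |((k₃ + k₁ : ℤ) : ℝ)| + |(k₂ : ℝ)| * |(k₃ : ℝ)| := by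
        rw [← abs_mul, ← abs_mul, ← abs_mul]
        refine le_trans (le_of_eq ?_) (abs_sub _ _)
        push_cast; ring_nf
      have h2 : |((k₁ + k₂ + k₃ : ℤ) : ℝ)| ≤ |((k₃ + k₁ : ℤ) : ℝ)| + |(k₂ : ℝ)| := by
        refine le_trans (le_of_eq ?_) (abs_add_le _ _)
        push_cast; ring_nf
      have h3 : |(k₁ : ℝ)| ≤ |((k₁ + k₂ : ℤ) : ℝ)| + |(k₂ : ℝ)| := by
        refine le_trans (le_of_eq ?_) (abs_sub _ _)
        push_cast; ring_nf
      unfold jb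
      nlinarith [abs_nonneg (k₂ : ℝ), abs_nonneg (k₃ : ℝ),
        mul_nonneg (abs_nonneg (k₂ : ℝ)) (abs_nonneg (k₃ : ℝ)),
        mul_nonneg (sub_nonneg.2 ha1) (sub_nonneg.2 hb1)]
    have : 0 ≤ A * B * (P * Q) := by positivity
    nlinarith
  have hden : (((3 * (k₁ + k₂) * (k₂ + k₃) * (k₃ + k₁) : ℤ) : ℝ)) ^ 2 =
      9 * |((k₂ + k₃ : ℤ) : ℝ)| ^ 2 * (A ^ 4 * B ^ 4) := by
    rw [show A ^ 4 = (A ^ 2) ^ 2 by ring, show B ^ 4 = (B ^ 2) ^ 2 by ring, sA, sB]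
    simp only [sq_abs]
    push_cast; ring
  rw [hden, ← sq_abs ((k₁ + k₂ + k₃ : ℤ) : ℝ)]
  generalize |((k₂ + k₃ : ℤ) : ℝ)| = c at *
  have hc0 : 0 < c := by linarith
  calc _ ≤ (c * (A ^ 2 + B ^ 2)) ^ 2 * (2 * (A * B + P * Q)) /
        (9 * c ^ 2 * (A ^ 4 * B ^ 4) * (P * Q)) := by gcongr
    _ = 2 / 9 * ((A ^ 2 + B ^ 2) ^ 2 * (A * B + P * Q) / (A ^ 4 * B ^ 4 * (P * Q))) := by
        field_simp
    _ ≤ 2 / 9 * (16 * (A⁻¹ ^ 3 + B⁻¹ ^ 3 + P⁻¹ ^ 3 + Q⁻¹ ^ 3)) := by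
        gcongr; exact kernel_aux A1 B1 P1 Q1 hAB hBA
    _ ≤ _ := by
        change _ ≤ 128 * (_ + _ + P⁻¹ ^ 3 + Q⁻¹ ^ 3)
        change 0 ≤ P⁻¹ ^ 3 at wp
        change 0 ≤ Q⁻¹ ^ 3 at wq
        linarith [weight_nonneg (k₁ + k₂), weight_nonneg (k₃ + k₁)]

/-- Cauchy–Schwarz for sums in `[0,∞]`. -/
lemma ENNReal.tsum_mul_le_sqrt_mul_sqrt {ι : Type*} (f g : ι → ℝ≥0∞) :
    ∑' i, f i * g i ≤ (∑' i, f i ^ 2) ^ (1 / 2 : ℝ) * (∑' i, g i ^ 2) ^ (1 / 2 : ℝ) := by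
  rw [ENNReal.tsum_eq_iSup_sum]
  refine iSup_le fun t => (ENNReal.inner_le_Lp_mul_Lq t f g Real.HolderConjugate.two_two).trans ?_
  simp only [ENNReal.rpow_two]
  gcongr <;> exact ENNReal.sum_le_tsum t

/-- The kernel `M₁` restricted to `Φ ≠ 0`, as an extended nonnegative real. -/
noncomputable def kernel (s : ℝ) (k k₁ k₂ : ℤ) : ℝ≥0∞ :=
  ENNReal.ofReal (if Phi k₁ k₂ (k - k₁ - k₂) ≠ 0 then M1 s k₁ k₂ (k - k₁ - k₂) else 0)

lemma tsum_kernel_sq_le {s : ℝ} (hs : 1 / 4 ≤ s) (k k₁ : ℤ) :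
    ∑' k₂, kernel s k k₁ k₂ ^ 2 ≤ ENNReal.ofReal (512 * ∑' n, weight n) := by
  have s1 : Summable fun k₂ => weight (k₁ + k₂) := summable_weight.comp_injective (Equiv.addLeft k₁).injective
  have t1 : ∑' k₂, weight (k₁ + k₂) = ∑' n, weight n := (Equiv.addLeft k₁).tsum_eq weight
  have s2 : Summable fun k₂ => weight (k - k₂) := summable_weight.comp_injective (Equiv.subLeft k).injective
  have t2 : ∑' k₂, weight (k - k₂) = ∑' n, weight n := (Equiv.subLeft k).tsum_eq weight
  have s3 : Summable fun k₂ => weight (k - k₁ - k₂) :=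
    summable_weight.comp_injective (Equiv.subLeft (k - k₁)).injective
  have t3 : ∑' k₂, weight (k - k₁ - k₂) = ∑' n, weight n :=
    (Equiv.subLeft (k - k₁)).tsum_eq weight
  have hS := (((s1.add s2).add summable_weight).add s3).mul_left 128
  have hT : ∑' k₂, 128 * (weight (k₁ + k₂) + weight (k - k₂) + weight k₂ + weight (k - k₁ - k₂)) =
      512 * ∑' n, weight n := by
    rw [tsum_mul_left, ((s1.add s2).add summable_weight).tsum_add s3,
      (s1.add s2).tsum_add summable_weight, s1.tsum_add s2, t1, t2, t3]
    ring
  have hnn (k₂ : ℤ) :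
      0 ≤ 128 * (weight (k₁ + k₂) + weight (k - k₂) + weight k₂ + weight (k - k₁ - k₂)) := by
    have h := weight_nonneg
    have := h (k₁ + k₂); have := h (k - k₂); have := h k₂; have := h (k - k₁ - k₂)
    positivity
  have hpt (k₂ : ℤ) : kernel s k k₁ k₂ ^ 2 ≤ ENNReal.ofReal
      (128 * (weight (k₁ + k₂) + weight (k - k₂) + weight k₂ + weight (k - k₁ - k₂))) := by
    unfold kernel
    split_ifs with h
    · rw [← ENNReal.ofReal_pow (M1_nonneg _ _ _ _)]
      refine ENNReal.ofReal_le_ofReal ?_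
      have hM := M1_sq_le_weight hs h
      rwa [show k - k₁ - k₂ + k₁ = k - k₂ by ring] at hM
    · simp
  rw [← hT, ENNReal.ofReal_tsum_of_nonneg hnn hS]
  exact ENNReal.tsum_le_tsum hpt

/-- A trilinear form on `ℓ²` is bounded once its kernel is square summable along each fibre. -/
lemma tsum_kernel_mul_le (K : ℤ → ℤ → ℝ≥0∞) (D : ℝ≥0∞) (m : ℤ)
    (hK : ∀ k, ∑' j, K k j ^ 2 ≤ D) (U V Z : ℤ → ℝ≥0∞) :
    ∑' k, ∑' j, K k j * (U j * V (k - m - j) * Z k) ≤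
      D ^ (1 / 2 : ℝ) * (∑' j, U j ^ 2) ^ (1 / 2 : ℝ) * (∑' j, V j ^ 2) ^ (1 / 2 : ℝ) *
        (∑' k, Z k ^ 2) ^ (1 / 2 : ℝ) := by
  have hconv : ∑' k, ∑' j, (U j * V (k - m - j)) ^ 2 = (∑' j, U j ^ 2) * ∑' j, V j ^ 2 := by
    rw [ENNReal.tsum_comm, ← ENNReal.tsum_mul_right]
    refine tsum_congr fun j => ?_
    simp only [mul_pow, sub_sub]
    rw [ENNReal.tsum_mul_left, ← (Equiv.subRight (m + j)).tsum_eq fun i => V i ^ 2]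
    rfl
  have hsq (x : ℝ≥0∞) : (x ^ (1 / 2 : ℝ)) ^ 2 = x := by
    rw [← ENNReal.rpow_natCast, ← ENNReal.rpow_mul]; norm_num
  calc ∑' k, ∑' j, K k j * (U j * V (k - m - j) * Z k)
      = ∑' k, (∑' j, K k j * (U j * V (k - m - j))) * Z k := by
        simp only [← ENNReal.tsum_mul_right, mul_assoc]
    _ ≤ ∑' k, (D ^ (1 / 2 : ℝ) * (∑' j, (U j * V (k - m - j)) ^ 2) ^ (1 / 2 : ℝ)) * Z k := by
        refine ENNReal.tsum_le_tsum fun k => ?_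
        gcongr
        refine (ENNReal.tsum_mul_le_sqrt_mul_sqrt _ _).trans ?_
        gcongr
        exact hK k
    _ = D ^ (1 / 2 : ℝ) * ∑' k, (∑' j, (U j * V (k - m - j)) ^ 2) ^ (1 / 2 : ℝ) * Z k := by
        simp only [← ENNReal.tsum_mul_left, mul_assoc]
    _ ≤ D ^ (1 / 2 : ℝ) * (((∑' j, U j ^ 2) * ∑' j, V j ^ 2) ^ (1 / 2 : ℝ) *
          (∑' k, Z k ^ 2) ^ (1 / 2 : ℝ)) := by
        gcongr
        refine (ENNReal.tsum_mul_le_sqrt_mul_sqrt _ _).trans ?_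
        simp only [hsq, hconv]
        exact le_rfl
    _ = _ := by
        rw [ENNReal.mul_rpow_of_nonneg _ _ (by norm_num)]
        ring

/-- The embedding `ℓ² ⊂ ℓ³`. -/
lemma ENNReal.tsum_pow_three_le {ι : Type*} (U : ι → ℝ≥0∞) :
    ∑' i, U i ^ 3 ≤ ((∑' i, U i ^ 2) ^ (1 / 2 : ℝ)) ^ 3 := by
  set N := (∑' i, U i ^ 2) ^ (1 / 2 : ℝ) with hN
  have hsq : N ^ 2 = ∑' i, U i ^ 2 := by
    rw [hN, ← ENNReal.rpow_natCast, ← ENNReal.rpow_mul]; norm_num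
  have hle (i : ι) : U i ≤ N := by
    rw [← ENNReal.pow_le_pow_left_iff two_ne_zero, hsq]
    exact ENNReal.le_tsum i
  calc ∑' i, U i ^ 3 ≤ ∑' i, U i ^ 2 * N := by
        refine ENNReal.tsum_le_tsum fun i => ?_
        rw [pow_succ]
        gcongr
        exact hle i
    _ = N ^ 3 := by rw [ENNReal.tsum_mul_right, ← hsq, ← pow_succ]

/-- Weighted convolution estimate with multiplier `M₁`, for `s ≥ 1/4`.
The sum runs over `(k, k₁, k₂)` with `k₃ = k - k₁ - k₂` and `Φ(k̄) ≠ 0`. -/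
theorem M1_estimate (s : ℝ) (hs : 1 / 4 ≤ s) :
    ∃ C > (0 : ℝ), ∀ u z : ℤ → ℝ, (∀ k, 0 ≤ u k) → (∀ k, 0 ≤ z k) →
      l2 u < ⊤ → l2 z < ⊤ →
      (∑' p : ℤ × ℤ × ℤ,
        ENNReal.ofReal
          (if Phi p.2.1 p.2.2 (p.1 - p.2.1 - p.2.2) ≠ 0 then
            M1 s p.2.1 p.2.2 (p.1 - p.2.1 - p.2.2) *
              (u p.2.1 ^ 3 * u p.2.2 * u (p.1 - p.2.1 - p.2.2) * z p.1)
          else 0)) ≤ ENNReal.ofReal C * l2 u ^ 5 * l2 z := by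
  have hW : 0 ≤ ∑' n, weight n := tsum_nonneg weight_nonneg
  set D : ℝ := 512 * ∑' n, weight n
  have hD0 : 0 ≤ D := by positivity
  refine ⟨D ^ (1 / 2 : ℝ) + 1, by positivity, fun u z hu hz _ _ => ?_⟩
  set U : ℤ → ℝ≥0∞ := fun k => ENNReal.ofReal (u k) with hU
  set Z : ℤ → ℝ≥0∞ := fun k => ENNReal.ofReal (z k) with hZ
  have lu : l2 u = (∑' k, U k ^ 2) ^ (1 / 2 : ℝ) := by
    simp only [l2, hU, ENNReal.ofReal_pow (hu _)]
  have lz : l2 z = (∑' k, Z k ^ 2) ^ (1 / 2 : ℝ) := by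
    simp only [l2, hZ, ENNReal.ofReal_pow (hz _)]
  have hterm (k k₁ k₂ : ℤ) : ENNReal.ofReal
      (if Phi k₁ k₂ (k - k₁ - k₂) ≠ 0 then
        M1 s k₁ k₂ (k - k₁ - k₂) * (u k₁ ^ 3 * u k₂ * u (k - k₁ - k₂) * z k) else 0) =
      U k₁ ^ 3 * (kernel s k k₁ k₂ * (U k₂ * U (k - k₁ - k₂) * Z k)) := by
    simp only [hU, hZ, kernel]
    split_ifs
    · rw [ENNReal.ofReal_mul (M1_nonneg _ _ _ _), ENNReal.ofReal_mul' (hz _),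
        ENNReal.ofReal_mul' (hu _), ENNReal.ofReal_mul' (hu _), ENNReal.ofReal_pow (hu _)]
      ring
    · simp
  simp only [ENNReal.tsum_prod', hterm]
  rw [ENNReal.tsum_comm]
  simp only [ENNReal.tsum_mul_left]
  calc ∑' k₁, U k₁ ^ 3 * ∑' k, ∑' k₂, kernel s k k₁ k₂ * (U k₂ * U (k - k₁ - k₂) * Z k)
      ≤ ∑' k₁, U k₁ ^ 3 * (ENNReal.ofReal D ^ (1 / 2 : ℝ) * l2 u * l2 u * l2 z) := by
        rw [lu, lz]
        refine ENNReal.tsum_le_tsum fun k₁ => ?_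
        gcongr
        exact tsum_kernel_mul_le (fun k k₂ => kernel s k k₁ k₂) _ k₁
          (fun k => tsum_kernel_sq_le hs k k₁) U U Z
    _ ≤ l2 u ^ 3 * (ENNReal.ofReal D ^ (1 / 2 : ℝ) * l2 u * l2 u * l2 z) := by
        rw [ENNReal.tsum_mul_right]
        gcongr
        rw [lu]
        exact ENNReal.tsum_pow_three_le U
    _ = ENNReal.ofReal D ^ (1 / 2 : ℝ) * l2 u ^ 5 * l2 z := by ring
    _ ≤ ENNReal.ofReal (D ^ (1 / 2 : ℝ) + 1) * l2 u ^ 5 * l2 z := by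
        gcongr
        rw [ENNReal.ofReal_rpow_of_nonneg hD0 (by norm_num)]
        exact ENNReal.ofReal_le_ofReal (by linarith)
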